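/- arXiv:2305.05088 — 2 statements merged into one kernel-verified Lean document; each statement's English description precedes it below -/
import Mathlib

section
/- There exist constants C_H ≥ 10 (the absolute constant of Lemma 2.1) and a universal constant C₂ > 0 such that the following holds. Let {D_j} be a finite collection of 100-separated closed unit disks in the plane with 0 ∉ ∪_j 3D_j. For some R ≥ 2^{10}, let h be a real-valued harmonic function in B(0,R) ∖ ∪_j D_j such that for each j, h does not change sign in (5D_j ∖ D_j) ∩ B(0,R). Assume that for some S ∈ [R/4, R/2] and M > 0, sup_{z ∈ B(0, R − S/32) ∖ ∪ 3D_j} |h(z)| ≥ e^{−M} sup_{z ∈ B(0,R) ∖ ∪ 3D_j} |h(z)|. Then for every r ∈ (0, R/2^{10}), sup_{z ∈ B(0,r) ∖ ∪ 3D_j} |h(z)| ≥ (16r/R)^{K(R,M)} · sup_{z ∈ B(0, R − S/32) ∖ ∪ 3D_j} |h(z)|, where K(R,M) = max{6 C_H R, C₂ M}. -/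
/-- The Laplacian of a function `u : ℂ → ℝ`, viewing `ℂ` as `ℝ²`:
`Δu = ∂²u/∂x² + ∂²u/∂y²`. -/
noncomputable def planeLaplacian (u : ℂ → ℝ) (z : ℂ) : ℝ :=
  fderiv ℝ (fun w => fderiv ℝ u w 1) z 1
    + fderiv ℝ (fun w => fderiv ℝ u w Complex.I) z Complex.I

open InnerProductSpace Metric Complex

/-- The complex gradient `h_x - i h_y` of a real function on the plane. -/
noncomputable def complexGradient (h : ℂ → ℝ) (z : ℂ) : ℂ :=
  fderiv ℝ h z 1 - I * fderiv ℝ h z I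

theorem fderiv_apply_eq_re_complexGradient_mul (h : ℂ → ℝ) (z v : ℂ) :
    fderiv ℝ h z v = (complexGradient h z * v).re := by
  have hv : v = v.re • (1 : ℂ) + v.im • I := by simp [Complex.re_add_im]
  conv_lhs => rw [hv, map_add, map_smul, map_smul]
  simp [complexGradient]
  ring

theorem abs_fderiv_apply_le_norm_complexGradient_mul (h : ℂ → ℝ) (z v : ℂ) :
    |fderiv ℝ h z v| ≤ ‖complexGradient h z‖ * ‖v‖ := by
  rw [fderiv_apply_eq_re_complexGradient_mul, ← norm_mul]
  exact abs_re_le_norm _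

theorem complexGradient_re {F : ℂ → ℂ} {F' z : ℂ} (hF : HasDerivAt F F' z) :
    complexGradient (fun w => (F w).re) z = F' := by
  have h1 : HasFDerivAt (fun w => (F w).re) _ z :=
    reCLM.hasFDerivAt.comp z (hF.hasFDerivAt.restrictScalars ℝ)
  rw [complexGradient, h1.fderiv]
  apply Complex.ext <;> simp

theorem complexGradient_add_const (h : ℂ → ℝ) (a : ℝ) (z : ℂ) :
    complexGradient (fun w => h w + a) z = complexGradient h z := by
  simp [complexGradient, fderiv_add_const]

theorem complexGradient_neg (h : ℂ → ℝ) (z : ℂ) :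
    complexGradient (-h) z = -complexGradient h z := by
  simp [complexGradient, fderiv_neg]
  ring

/-- Schwarz-Pick gradient estimate for nonnegative harmonic functions. -/
theorem norm_complexGradient_le_of_nonneg {h : ℂ → ℝ} {z : ℂ} {s : ℝ} (hs : 0 < s)
    (hh : HarmonicOnNhd h (ball z s)) (h0 : ∀ w ∈ ball z s, 0 ≤ h w) :
    ‖complexGradient h z‖ ≤ 2 * h z / s := by
  obtain ⟨F, hF, hre⟩ := hh.exists_analyticOnNhd_ball_re_eq
  have hz : z ∈ ball z s := mem_ball_self hs
  have hFz : HasDerivAt F (deriv F z) z := (hF z hz).differentiableAt.hasDerivAt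
  have hgrad : complexGradient h z = deriv F z := by
    rw [← complexGradient_re hFz]
    have : h =ᶠ[nhds z] fun w => (F w).re := by
      filter_upwards [isOpen_ball.mem_nhds hz] with w hw
      exact (hre hw).symm
    simp only [complexGradient, this.fderiv_eq]
  have hval : ∀ w ∈ ball z s, 0 ≤ (F w).re := fun w hw => by
    have : (F w).re = h w := hre hw
    rw [this]; exact h0 w hw
  have hhz : (F z).re = h z := hre hz
  rw [hgrad, ← hhz, le_div_iff₀ hs]
  refine le_of_forall_pos_le_add fun ε hε => ?_
  set b : ℂ := (starRingEnd ℂ) (F z) + (ε : ℝ) with hb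
  have hne : ∀ w ∈ ball z s, F w + b ≠ 0 := fun w hw he => by
    have := congrArg Complex.re he
    simp [hb] at this
    linarith [hval w hw, hval z hz]
  let G : ℂ → ℂ := fun w => (F w - F z) / (F w + b)
  have hGd : DifferentiableOn ℂ G (ball z s) := fun w hw => by
    have := (hF w hw).differentiableAt
    exact ((this.sub_const _).div (this.add_const _) (hne w hw)).differentiableWithinAt
  have hG1 : Set.MapsTo G (ball z s) (ball (G z) 1) := fun w hw => by
    have : G z = 0 := by simp [G]
    rw [this, mem_ball_zero_iff]
    simp only [G]
    rw [norm_div, div_lt_one (norm_pos_iff.2 (hne w hw)), ← sq_lt_sq₀ (norm_nonneg _) (norm_nonneg _),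
      ← normSq_eq_norm_sq, ← normSq_eq_norm_sq, normSq_apply, normSq_apply]
    simp [hb]
    nlinarith [hval w hw, hval z hz, mul_nonneg (hval w hw) (hval z hz)]
  have key := norm_deriv_le_div_of_mapsTo_ball hGd (hG1.mono_right ball_subset_closedBall) hs
  have hGz : HasDerivAt G (deriv F z / (F z + b)) z := by
    refine ((hFz.sub_const (F z)).div (hFz.add_const b) (hne z hz)).congr_deriv ?_
    rw [sub_self, zero_mul, sub_zero, pow_two, mul_div_mul_right _ _ (hne z hz)]
  rw [hGz.deriv, norm_div] at key
  have hbz : ‖F z + b‖ = 2 * (F z).re + ε := by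
    have : F z + b = ((2 * (F z).re + ε : ℝ) : ℂ) := by
      apply Complex.ext <;> simp [hb]
      ring
    rw [this, Complex.norm_of_nonneg (by linarith [hval z hz])]
  rw [hbz, div_le_div_iff₀ (by linarith [hval z hz]) hs] at key
  linarith

theorem norm_complexGradient_le_of_abs_le {h : ℂ → ℝ} {z : ℂ} {s N : ℝ} (hs : 0 < s)
    (hh : HarmonicOnNhd h (ball z s)) (hN : ∀ w ∈ ball z s, |h w| ≤ N) :
    ‖complexGradient h z‖ ≤ 4 * N / s := by
  have hc : HarmonicOnNhd (fun _ : ℂ => N) (ball z s) := fun w _ => by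
    refine ⟨contDiffAt_const, ?_⟩
    simp [laplacian_const]
  have := norm_complexGradient_le_of_nonneg hs (hh.add hc)
    (fun w hw => by simp; linarith [(abs_le.1 (hN w hw)).1])
  have e : h + (fun _ : ℂ => N) = fun w => h w + N := rfl
  rw [e, complexGradient_add_const] at this
  refine this.trans (div_le_div_of_nonneg_right ?_ hs.le)
  linarith [(abs_le.1 (hN z (mem_ball_self hs))).2]

theorem norm_complexGradient_le_of_sign {h : ℂ → ℝ} {z : ℂ} {s : ℝ} (hs : 0 < s)
    (hh : HarmonicOnNhd h (ball z s))
    (h0 : (∀ w ∈ ball z s, 0 ≤ h w) ∨ (∀ w ∈ ball z s, h w ≤ 0)) :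
    ‖complexGradient h z‖ ≤ 2 * |h z| / s := by
  have hz : z ∈ ball z s := mem_ball_self hs
  rcases h0 with h0 | h0
  · rw [abs_of_nonneg (h0 z hz)]
    exact norm_complexGradient_le_of_nonneg hs hh h0
  · rw [abs_of_nonpos (h0 z hz), ← norm_neg, ← complexGradient_neg]
    exact norm_complexGradient_le_of_nonneg hs hh.neg (fun w hw => by simpa using h0 w hw)

/-- Harnack's inequality in the annulus `3 ≤ |z - c| ≤ 7/2`. -/
theorem harnack_annulus_of_nonneg {h : ℂ → ℝ} {c : ℂ}
    (hh : ∀ p, 3 ≤ ‖p - c‖ → ‖p - c‖ ≤ 7 / 2 →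
      HarmonicOnNhd h (ball p (1 / 2)) ∧ ∀ w ∈ ball p (1 / 2), 0 ≤ h w)
    {p q : ℂ} (hp : 3 ≤ ‖p - c‖) (hp' : ‖p - c‖ ≤ 7 / 2) (hq : 3 ≤ ‖q - c‖)
    (hq' : ‖q - c‖ ≤ 7 / 2) : h p ≤ Real.exp 112 * h q := by
  have hp0 : p - c ≠ 0 := norm_pos_iff.1 (by linarith)
  have hq0 : q - c ≠ 0 := norm_pos_iff.1 (by linarith)
  set a := log (p - c)
  set b := log (q - c)
  let γ : ℝ → ℂ := fun t => c + exp (a + t * (b - a))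
  have hγ0 : γ 0 = p := by simp [γ, a, exp_log hp0]
  have hγ1 : γ 1 = q := by simp [γ, b, exp_log hq0]
  have hare : a.re = Real.log ‖p - c‖ := log_re _
  have hbre : b.re = Real.log ‖q - c‖ := log_re _
  have hl3 : Real.log 3 ≤ a.re := hare ▸ Real.log_le_log (by norm_num) hp
  have hl3' : Real.log 3 ≤ b.re := hbre ▸ Real.log_le_log (by norm_num) hq
  have hl7 : a.re ≤ Real.log (7 / 2) := hare ▸ Real.log_le_log (by linarith) hp'
  have hl7' : b.re ≤ Real.log (7 / 2) := hbre ▸ Real.log_le_log (by linarith) hq'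
  have hγn : ∀ t ∈ Set.Icc (0 : ℝ) 1, 3 ≤ ‖γ t - c‖ ∧ ‖γ t - c‖ ≤ 7 / 2 := by
    rintro t ⟨ht0, ht1⟩
    have : ‖γ t - c‖ = Real.exp (a.re + t * (b.re - a.re)) := by
      simp [γ, norm_exp]
    rw [this, ← Real.log_le_iff_le_exp (by norm_num), ← Real.le_log_iff_exp_le (by norm_num)]
    constructor <;> nlinarith
  have hba : ‖b - a‖ ≤ 8 := by
    refine (norm_le_abs_re_add_abs_im _).trans ?_
    have h1 : |(b - a).re| ≤ 1 := by
      have h72 : Real.log (7 / 2) - Real.log 3 ≤ 1 := by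
        rw [← Real.log_div (by norm_num) (by norm_num)]
        refine (Real.log_le_sub_one_of_pos (by norm_num)).trans (by norm_num)
      rw [sub_re, abs_le]
      constructor <;> linarith
    have h2 : |(b - a).im| ≤ 7 := by
      have := abs_le.1 (abs_arg_le_pi (p - c))
      have := abs_le.1 (abs_arg_le_pi (q - c))
      have e1 : a.im = arg (p - c) := log_im _
      have e2 : b.im = arg (q - c) := log_im _
      have := Real.pi_lt_d2
      rw [sub_im, abs_le, e1, e2]
      constructor <;> linarith
    linarith
  have hγd : ∀ t : ℝ, HasDerivAt γ (exp (a + t * (b - a)) * (b - a)) t := fun t => by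
    have h1 : HasDerivAt (fun t : ℝ => a + (t : ℂ) * (b - a)) (b - a) t := by
      simpa using ((ofRealCLM.hasDerivAt (x := t)).mul_const (b - a)).const_add a
    exact (h1.cexp).const_add c
  have hhd : ∀ t ∈ Set.Icc (0 : ℝ) 1, HasDerivAt (fun t => Real.exp (112 * t) * h (γ t))
      (Real.exp (112 * t) * 112 * h (γ t) +
        Real.exp (112 * t) * fderiv ℝ h (γ t) (exp (a + t * (b - a)) * (b - a))) t := by
    intro t ht
    obtain ⟨h3, h7⟩ := hγn t ht
    have hd : DifferentiableAt ℝ h (γ t) :=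
      ((hh _ h3 h7).1 _ (mem_ball_self (by norm_num))).1.differentiableAt two_ne_zero
    have h1 := hd.hasFDerivAt.comp_hasDerivAt t (hγd t)
    have h2 : HasDerivAt (fun t : ℝ => Real.exp (112 * t)) (Real.exp (112 * t) * 112) t := by
      simpa using ((hasDerivAt_id t).const_mul 112).exp
    exact h2.mul h1
  have hmono : MonotoneOn (fun t => Real.exp (112 * t) * h (γ t)) (Set.Icc 0 1) := by
    refine monotoneOn_of_deriv_nonneg (convex_Icc 0 1)
      (fun t ht => (hhd t ht).continuousAt.continuousWithinAt)
      (fun t ht => (hhd t (interior_subset ht)).differentiableAt.differentiableWithinAt) ?_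
    intro t ht
    have ht := interior_subset ht
    rw [(hhd t ht).deriv]
    obtain ⟨h3, h7⟩ := hγn t ht
    obtain ⟨hharm, hpos⟩ := hh _ h3 h7
    have hgrad := norm_complexGradient_le_of_nonneg (by norm_num) hharm hpos
    have hf := (abs_le.1 (abs_fderiv_apply_le_norm_complexGradient_mul h (γ t)
      (exp (a + t * (b - a)) * (b - a)))).1
    have hn : ‖exp (a + t * (b - a)) * (b - a)‖ ≤ 28 := by
      have : ‖exp (a + t * (b - a))‖ ≤ 7 / 2 := by simpa [γ] using h7
      rw [norm_mul]
      nlinarith [norm_nonneg (b - a), norm_nonneg (exp (a + t * (b - a)))]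
    have hpos' := hpos _ (mem_ball_self (by norm_num))
    have : ‖complexGradient h (γ t)‖ * ‖exp (a + t * (b - a)) * (b - a)‖ ≤
        (2 * h (γ t) / (1 / 2)) * 28 :=
      mul_le_mul hgrad hn (norm_nonneg _) (by positivity)
    rw [mul_assoc, ← mul_add]
    refine mul_nonneg (Real.exp_pos _).le ?_
    linarith
  have := hmono (Set.left_mem_Icc.2 zero_le_one) (Set.right_mem_Icc.2 zero_le_one) zero_le_one
  simpa [hγ0, hγ1] using this

theorem harnack_annulus {h : ℂ → ℝ} {c : ℂ}
    (hh : ∀ p, 3 ≤ ‖p - c‖ → ‖p - c‖ ≤ 7 / 2 → HarmonicOnNhd h (ball p (1 / 2)))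
    (h0 : (∀ p, 3 ≤ ‖p - c‖ → ‖p - c‖ ≤ 7 / 2 → ∀ w ∈ ball p (1 / 2), 0 ≤ h w) ∨
      (∀ p, 3 ≤ ‖p - c‖ → ‖p - c‖ ≤ 7 / 2 → ∀ w ∈ ball p (1 / 2), h w ≤ 0))
    {p q : ℂ} (hp : 3 ≤ ‖p - c‖) (hp' : ‖p - c‖ ≤ 7 / 2) (hq : 3 ≤ ‖q - c‖)
    (hq' : ‖q - c‖ ≤ 7 / 2) : |h p| ≤ Real.exp 112 * |h q| := by
  have hself : ∀ p : ℂ, p ∈ ball p (1 / 2 : ℝ) := fun p => mem_ball_self (by norm_num)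
  rcases h0 with h0 | h0
  · rw [abs_of_nonneg (h0 p hp hp' p (hself p)), abs_of_nonneg (h0 q hq hq' q (hself q))]
    exact harnack_annulus_of_nonneg (fun p h1 h2 => ⟨hh p h1 h2, h0 p h1 h2⟩) hp hp' hq hq'
  · rw [abs_of_nonpos (h0 p hp hp' p (hself p)), abs_of_nonpos (h0 q hq hq' q (hself q))]
    exact harnack_annulus_of_nonneg (h := -h) (fun p h1 h2 => ⟨(hh p h1 h2).neg,
      fun w hw => by simpa using h0 p h1 h2 w hw⟩) hp hp' hq hq'

theorem nonneg_of_hasDerivAt_of_eventually_right {ψ : ℝ → ℝ} {ψ' x : ℝ} (hψ : HasDerivAt ψ ψ' x)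
    (hpos : ∀ᶠ t in nhdsWithin x (Set.Ioi x), ψ x ≤ ψ t) : 0 ≤ ψ' := by
  have h1 := (hasDerivWithinAt_iff_tendsto_slope' (s := Set.Ioi x) (by simp)).1
    hψ.hasDerivWithinAt
  refine ge_of_tendsto h1 ?_
  filter_upwards [hpos, self_mem_nhdsWithin] with t ht ht'
  rw [slope_def_field]
  exact div_nonneg (sub_nonneg.2 ht) (sub_nonneg.2 (le_of_lt ht'))

theorem exists_inner_point_annulus {c : ℂ} (hc : 3 < ‖c‖) :
    ∃ q : ℂ, 3 ≤ ‖q - c‖ ∧ ‖q - c‖ ≤ 7 / 2 ∧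
      (q = 0 ∨ (‖q - c‖ = 7 / 2 ∧ ‖q‖ = ‖c‖ - 7 / 2)) := by
  rcases lt_or_ge ‖c‖ (7 / 2) with h | h
  · exact ⟨0, by simpa using hc.le, by simpa using h.le, Or.inl rfl⟩
  · have h0 : ‖c‖ ≠ 0 := by linarith
    have e1 : ‖((1 - 7 / 2 / ‖c‖ : ℝ) : ℂ) * c - c‖ = 7 / 2 := by
      have : ((1 - 7 / 2 / ‖c‖ : ℝ) : ℂ) * c - c = -(((7 / 2 / ‖c‖ : ℝ) : ℂ) * c) := by
        push_cast; ring
      rw [this, norm_neg, norm_mul, Complex.norm_of_nonneg (by positivity)]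
      field_simp
    refine ⟨((1 - 7 / 2 / ‖c‖ : ℝ) : ℂ) * c, by rw [e1]; norm_num, e1.le, Or.inr ⟨e1, ?_⟩⟩
    have : 7 / 2 / ‖c‖ ≤ 1 := (div_le_one (by linarith)).2 h
    rw [norm_mul, Complex.norm_of_nonneg (by linarith)]
    field_simp

/-- The closed annulus `ρ ≤ |z| ≤ T` with open disks of radius `7/2` around the `c j` removed. -/
def perforatedAnnulus {n : ℕ} (c : Fin n → ℂ) (ρ T : ℝ) : Set ℂ :=
  {z | ρ ≤ ‖z‖ ∧ ‖z‖ ≤ T ∧ ∀ j, 7 / 2 ≤ ‖z - c j‖}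

theorem isClosed_perforatedAnnulus {n : ℕ} (c : Fin n → ℂ) (ρ T : ℝ) :
    IsClosed (perforatedAnnulus c ρ T) := by
  have : perforatedAnnulus c ρ T =
      {z | ρ ≤ ‖z‖} ∩ ({z | ‖z‖ ≤ T} ∩ ⋂ j, {z | 7 / 2 ≤ ‖z - c j‖}) := by
    ext z; simp [perforatedAnnulus]
  rw [this]
  refine (isClosed_le (by fun_prop) (by fun_prop)).inter
    ((isClosed_le (by fun_prop) (by fun_prop)).inter
      (isClosed_iInter fun j => isClosed_le (by fun_prop) (by fun_prop)))

theorem isCompact_perforatedAnnulus {n : ℕ} (c : Fin n → ℂ) (ρ T : ℝ) :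
    IsCompact (perforatedAnnulus c ρ T) := by
  refine isCompact_of_isClosed_isBounded (isClosed_perforatedAnnulus c ρ T)
    ((isBounded_closedBall (x := (0 : ℂ)) (r := T)).subset fun z hz => ?_)
  simpa using hz.2.1

/-- Moving radially inward stays in the perforated annulus, from a point whose adjacent holes
are not hit by the inward direction. -/
theorem eventually_mul_mem_perforatedAnnulus {n : ℕ} {c : Fin n → ℂ} {ρ T : ℝ} {z : ℂ}
    (hz : z ∈ perforatedAnnulus c ρ T) (hρ : ρ < ‖z‖)
    (hin : ∀ j, ‖z - c j‖ = 7 / 2 → ((z - c j) * (starRingEnd ℂ) z).re < 0) :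
    ∀ᶠ t : ℝ in nhdsWithin 0 (Set.Ioi 0), ((1 - t : ℝ) : ℂ) * z ∈ perforatedAnnulus c ρ T := by
  have hcont : Filter.Tendsto (fun t : ℝ => ((1 - t : ℝ) : ℂ) * z)
      (nhdsWithin 0 (Set.Ioi 0)) (nhds z) := by
    have : ContinuousAt (fun t : ℝ => ((1 - t : ℝ) : ℂ) * z) 0 := by fun_prop
    have h2 := this.tendsto.mono_left (nhdsWithin_le_nhds (s := Set.Ioi 0))
    simpa using h2
  have hj : ∀ j, ∀ᶠ t : ℝ in nhdsWithin 0 (Set.Ioi 0),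
      7 / 2 ≤ ‖((1 - t : ℝ) : ℂ) * z - c j‖ := by
    intro j
    rcases (hz.2.2 j).lt_or_eq with h | h
    · have := (hcont.sub_const (c j)).norm.eventually (lt_mem_nhds h)
      filter_upwards [this] with t ht using ht.le
    · have hneg := hin j h.symm
      filter_upwards [self_mem_nhdsWithin] with t (ht : 0 < t)
      rw [← sq_le_sq₀ (by norm_num) (norm_nonneg _), h, ← normSq_eq_norm_sq, ← normSq_eq_norm_sq,
        normSq_apply, normSq_apply]
      simp at hneg ⊢
      nlinarith [mul_pos ht (neg_pos.2 hneg), mul_self_nonneg (t * z.re), mul_self_nonneg (t * z.im)]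
  have h1 := hcont.norm.eventually (lt_mem_nhds hρ)
  have h2 : ∀ᶠ t : ℝ in nhdsWithin 0 (Set.Ioi 0), t < 1 :=
    nhdsWithin_le_nhds (gt_mem_nhds one_pos)
  filter_upwards [h1, h2, self_mem_nhdsWithin, Filter.eventually_all.2 hj] with t ht ht1 ht0 htj
  refine ⟨ht.le, ?_, htj⟩
  rw [norm_mul, Complex.norm_of_nonneg (by linarith)]
  have : (0 : ℝ) < t := ht0
  nlinarith [hz.2.1, norm_nonneg z]

/-- At a point where `|h| / |z| ^ k` is maximal along the inward ray, the logarithmic gradient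
of `h` is at least `k / |z|`. -/
theorem mul_abs_le_of_isMax_inward {h : ℂ → ℝ} {z : ℂ} {k : ℕ} (hd : DifferentiableAt ℝ h z)
    (hmax : ∀ᶠ t : ℝ in nhdsWithin 0 (Set.Ioi 0), |h (((1 - t : ℝ) : ℂ) * z)| ≤ |h z| * (1 - t) ^ k) :
    k * |h z| ≤ ‖complexGradient h z‖ * ‖z‖ := by
  obtain ⟨σ, hσ, hσz⟩ : ∃ σ : ℝ, |σ| = 1 ∧ σ * h z = |h z| := by
    rcases le_total 0 (h z) with h0 | h0
    · exact ⟨1, by simp, by rw [abs_of_nonneg h0]; ring⟩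
    · exact ⟨-1, by simp, by rw [abs_of_nonpos h0]; ring⟩
  have hγ : HasDerivAt (fun t : ℝ => ((1 - t : ℝ) : ℂ) * z) (-z) 0 := by
    have h1 : HasDerivAt (fun t : ℝ => 1 - t) (-1) 0 := by
      simpa using (hasDerivAt_id (0 : ℝ)).const_sub 1
    simpa using h1.ofReal_comp.mul_const z
  have hd' : HasFDerivAt h (fderiv ℝ h z) ((fun t : ℝ => ((1 - t : ℝ) : ℂ) * z) 0) := by
    simpa using hd.hasFDerivAt
  have hcomp := hd'.comp_hasDerivAt (0 : ℝ) hγ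
  have hpow : HasDerivAt (fun t : ℝ => |h z| * (1 - t) ^ k) (|h z| * -(k : ℝ)) 0 := by
    have h1 : HasDerivAt (fun t : ℝ => 1 - t) (-1) 0 := by
      simpa using (hasDerivAt_id (0 : ℝ)).const_sub 1
    simpa using (h1.pow k).const_mul |h z|
  have hψ := hpow.sub (hcomp.const_mul σ)
  have := nonneg_of_hasDerivAt_of_eventually_right hψ (by
    filter_upwards [hmax] with t ht
    have h1 : σ * h (((1 - t : ℝ) : ℂ) * z) ≤ |h (((1 - t : ℝ) : ℂ) * z)| := by
      refine (le_abs_self _).trans ?_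
      rw [abs_mul, hσ, one_mul]
    simp only [Pi.sub_apply, Function.comp_apply]
    simp only [sub_zero, ofReal_one, one_mul, one_pow, mul_one, hσz]
    linarith)
  have h2 := abs_fderiv_apply_le_norm_complexGradient_mul h z z
  have h3 : σ * fderiv ℝ h z z ≤ |fderiv ℝ h z z| := by
    refine (le_abs_self _).trans ?_
    rw [abs_mul, hσ, one_mul]
  rw [map_neg] at this
  have h4 : σ * -fderiv ℝ h z z ≤ |fderiv ℝ h z z| := by
    refine (le_abs_self _).trans ?_
    rw [abs_mul, hσ, one_mul, abs_neg]
  linarith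

theorem lt_norm_sub_of_separated {n : ℕ} {c : Fin n → ℂ}
    (hsep : ∀ i j, i ≠ j → 102 ≤ ‖c i - c j‖) {i j : Fin n} (hij : i ≠ j) {q : ℂ}
    (hq : ‖q - c j‖ ≤ 7 / 2) : 98 < ‖q - c i‖ := by
  have h1 := hsep i j hij
  have h2 : ‖c i - c j‖ ≤ ‖q - c j‖ + ‖q - c i‖ := by
    have : c i - c j = (q - c j) - (q - c i) := by ring
    rw [this]; exact norm_sub_le _ _
  linarith

/-- On the part of the circle `|z - c| = 7/2` where the inward ray enters the disk, the point of
the circle closest to the origin is closer to the origin by a definite factor. -/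
theorem sq_norm_inner_point_le {c z q : ℂ} {T : ℝ} (hz : ‖z - c‖ = 7 / 2) (hzT : ‖z‖ ≤ T)
    (hout : 0 ≤ ((z - c) * (starRingEnd ℂ) z).re) (hq : ‖q‖ = ‖c‖ - 7 / 2) :
    ‖q‖ ^ 2 ≤ (1 - 7 / (T + 7)) * ‖z‖ ^ 2 := by
  have hc : ‖c‖ ^ 2 - 49 / 4 ≤ ‖z‖ ^ 2 := by
    have h1 : ‖z - c‖ ^ 2 = 49 / 4 := by rw [hz]; norm_num
    rw [← normSq_eq_norm_sq, normSq_apply] at h1 ⊢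
    rw [← normSq_eq_norm_sq, normSq_apply]
    simp at h1 hout
    nlinarith
  have hcT : ‖c‖ ≤ T + 7 / 2 := by
    have : ‖c‖ ≤ ‖z‖ + ‖z - c‖ := by
      have : c = z - (z - c) := by ring
      conv_lhs => rw [this]
      exact norm_sub_le _ _
    linarith
  have hT : 0 ≤ T := (norm_nonneg z).trans hzT
  have hq0 := norm_nonneg q
  have e : 1 - 7 / (T + 7) = T / (T + 7) := by field_simp; ring
  have hθ : 0 ≤ T / (T + 7) := by positivity
  rw [e]
  have h1 : ‖c‖ - 7 / 2 ≤ T / (T + 7) * (‖c‖ + 7 / 2) := by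
    rw [div_mul_eq_mul_div, le_div_iff₀ (by linarith)]
    nlinarith
  calc ‖q‖ ^ 2 = (‖c‖ - 7 / 2) * ‖q‖ := by rw [hq]; ring
    _ ≤ T / (T + 7) * (‖c‖ + 7 / 2) * ‖q‖ := by gcongr
    _ = T / (T + 7) * (‖c‖ ^ 2 - 49 / 4) := by rw [hq]; ring
    _ ≤ _ := by gcongr

theorem eq_zero_of_harnack_of_decay {a b x y Λ θ : ℝ} {k : ℕ} (ha : 0 ≤ a) (hy : 0 < y)
    (hab : a ≤ Λ * b) (hb : 0 ≤ b)
    (hmax : b * y ^ k ≤ a * x ^ k) (hxy : x ^ 2 ≤ θ * y ^ 2) (hθ : Λ ^ 2 * θ ^ k < 1) :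
    a = 0 := by
  by_contra hne
  have hapos : 0 < a := lt_of_le_of_ne ha (Ne.symm hne)
  have h1 : a ^ 2 ≤ Λ ^ 2 * b ^ 2 := by rw [← mul_pow]; gcongr
  have h2 : b ^ 2 * (y ^ 2) ^ k ≤ a ^ 2 * (x ^ 2) ^ k := by
    have := pow_le_pow_left₀ (by positivity) hmax 2
    calc b ^ 2 * (y ^ 2) ^ k = (b * y ^ k) ^ 2 := by ring
      _ ≤ (a * x ^ k) ^ 2 := this
      _ = _ := by ring
  have h3 : (x ^ 2) ^ k ≤ θ ^ k * (y ^ 2) ^ k := by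
    rw [← mul_pow]; gcongr
  have hyk : 0 < (y ^ 2) ^ k := by positivity
  have h4 : b ^ 2 ≤ a ^ 2 * θ ^ k := by
    refine le_of_mul_le_mul_right ?_ hyk
    calc b ^ 2 * (y ^ 2) ^ k ≤ a ^ 2 * (x ^ 2) ^ k := h2
      _ ≤ a ^ 2 * (θ ^ k * (y ^ 2) ^ k) := by gcongr
      _ = _ := by ring
  have h5 : a ^ 2 ≤ a ^ 2 * (Λ ^ 2 * θ ^ k) := by
    calc a ^ 2 ≤ Λ ^ 2 * b ^ 2 := h1
      _ ≤ Λ ^ 2 * (a ^ 2 * θ ^ k) := by gcongr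
      _ = _ := by ring
  nlinarith [pow_pos hapos 2]

/-- A weighted bound on the gradient of `h` yields a weighted bound on `h`. -/
theorem abs_le_of_norm_complexGradient_le {n : ℕ} {c : Fin n → ℂ} {h : ℂ → ℝ}
    {ρ T m Λ A : ℝ} {k : ℕ}
    (hsep : ∀ i j, i ≠ j → 102 ≤ ‖c i - c j‖) (hc : ∀ j, 3 < ‖c j‖) (hρ : 0 < ρ)
    (hk : 0 < k) (hΛ : 1 ≤ Λ) (hm0 : 0 ≤ m)
    (hd : ∀ z ∈ perforatedAnnulus c ρ T, DifferentiableAt ℝ h z)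
    (hm : ∀ z, ‖z‖ ≤ ρ → (∀ j, 3 < ‖z - c j‖) → |h z| ≤ m)
    (hH : ∀ z j, ‖z‖ ≤ T → ‖z - c j‖ ≤ 7 / 2 → ∀ p q, 3 ≤ ‖p - c j‖ → ‖p - c j‖ ≤ 7 / 2 →
      3 ≤ ‖q - c j‖ → ‖q - c j‖ ≤ 7 / 2 → |h p| ≤ Λ * |h q|)
    (hdecay : Λ ^ 2 * (1 - 7 / (T + 7)) ^ k < 1)
    (hA : ∀ z ∈ perforatedAnnulus c ρ T, ‖complexGradient h z‖ ≤ A * ‖z‖ ^ k) :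
    ∀ z ∈ perforatedAnnulus c ρ T, |h z| ≤ max (Λ * m / ρ ^ k) (T / k * A) * ‖z‖ ^ k := by
  set Ω := perforatedAnnulus c ρ T
  intro w hw
  have hpos : ∀ z ∈ Ω, 0 < ‖z‖ := fun z hz => hρ.trans_le hz.1
  have hcont : ContinuousOn (fun z => |h z| / ‖z‖ ^ k) Ω := fun z hz =>
    ((hd z hz).continuousAt.abs.div (by fun_prop)
      (pow_ne_zero _ (hpos z hz).ne')).continuousWithinAt
  obtain ⟨z, hz, hzmax⟩ := (isCompact_perforatedAnnulus c ρ T).exists_isMaxOn ⟨w, hw⟩ hcont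
  have hzpos := hpos z hz
  suffices hs : |h z| ≤ max (Λ * m / ρ ^ k) (T / k * A) * ‖z‖ ^ k by
    rw [← div_le_iff₀ (pow_pos (hpos w hw) k)]
    exact (hzmax hw).trans ((div_le_iff₀ (pow_pos hzpos k)).2 hs)
  have hΛ0 : 0 ≤ Λ := by linarith
  have hmax : ∀ x ∈ Ω, |h x| * ‖z‖ ^ k ≤ |h z| * ‖x‖ ^ k := fun x hx =>
    (div_le_div_iff₀ (pow_pos (hpos x hx) k) (pow_pos hzpos k)).1 (hzmax hx)
  have small : |h z| ≤ Λ * m → |h z| ≤ max (Λ * m / ρ ^ k) (T / k * A) * ‖z‖ ^ k := fun hle =>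
    calc |h z| ≤ Λ * m / ρ ^ k * ρ ^ k := by rw [div_mul_cancel₀ _ (pow_pos hρ k).ne']; exact hle
      _ ≤ max (Λ * m / ρ ^ k) (T / k * A) * ‖z‖ ^ k := by
        refine mul_le_mul (le_max_left _ _) (pow_le_pow_left₀ hρ.le hz.1 k) (by positivity) ?_
        exact le_max_of_le_left (by positivity)
  rcases hz.1.eq_or_lt with hzρ | hzρ
  · refine small ((hm z hzρ.ge fun j => ?_).trans (le_mul_of_one_le_left hm0 hΛ))
    linarith [hz.2.2 j]
  by_cases hin : ∀ j, ‖z - c j‖ = 7 / 2 → ((z - c j) * (starRingEnd ℂ) z).re < 0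
  · have hray := eventually_mul_mem_perforatedAnnulus hz hzρ hin
    have hlog : k * |h z| ≤ ‖complexGradient h z‖ * ‖z‖ := by
      refine mul_abs_le_of_isMax_inward (hd z hz) ?_
      have h2 : ∀ᶠ t : ℝ in nhdsWithin 0 (Set.Ioi 0), t < 1 :=
        nhdsWithin_le_nhds (gt_mem_nhds one_pos)
      filter_upwards [hray, h2] with t ht ht1
      have := hmax _ ht
      rw [norm_mul, Complex.norm_of_nonneg (by linarith), mul_pow, ← mul_assoc] at this
      exact le_of_mul_le_mul_right this (pow_pos hzpos k)
    have hkpos : (0 : ℝ) < k := by exact_mod_cast hk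
    have hgz := hA z hz
    calc |h z| ≤ ‖complexGradient h z‖ * ‖z‖ / k := by
          rw [le_div_iff₀ hkpos]; linarith
      _ ≤ A * ‖z‖ ^ k * T / k := by
          gcongr
          · exact (norm_nonneg _).trans hgz
          · exact hz.2.1
      _ = T / k * A * ‖z‖ ^ k := by ring
      _ ≤ _ := by gcongr; exact le_max_right _ _
  · push Not at hin
    obtain ⟨j, hj, hout⟩ := hin
    obtain ⟨q, hq3, hq7, hq⟩ := exists_inner_point_annulus (hc j)
    have hzq := hH z j hz.2.1 hj.le z q (by linarith) hj.le hq3 hq7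
    have hq_small : ‖q‖ ≤ ρ → (∀ i, 3 < ‖q - c i‖) → |h z| ≤ Λ * m := fun h1 h2 =>
      hzq.trans (mul_le_mul_of_nonneg_left (hm q h1 h2) hΛ0)
    rcases hq with rfl | ⟨hqc, hqn⟩
    · exact small (hq_small (by simpa using hρ.le) fun i => by simpa using hc i)
    have hqsep : ∀ i, 7 / 2 ≤ ‖q - c i‖ := fun i => by
      by_cases hij : i = j
      · rw [hij, hqc]
      · linarith [lt_norm_sub_of_separated hsep hij hq7]
    rcases lt_or_ge ‖q‖ ρ with hqρ | hqρ
    · exact small (hq_small hqρ.le fun i => by linarith [hqsep i])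
    have hsq := sq_norm_inner_point_le hj hz.2.1 hout hqn
    have hT : 0 ≤ T := hzpos.le.trans hz.2.1
    have hθ : 1 - 7 / (T + 7) ≤ 1 := by
      have : 0 ≤ 7 / (T + 7) := by positivity
      linarith
    have hqz : ‖q‖ ≤ ‖z‖ := by
      rw [← sq_le_sq₀ (norm_nonneg _) (norm_nonneg _)]
      nlinarith [sq_nonneg ‖z‖]
    have hqΩ : q ∈ Ω := ⟨hqρ, hqz.trans hz.2.1, hqsep⟩
    have h0 : |h z| = 0 := eq_zero_of_harnack_of_decay (abs_nonneg _) hzpos hzq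
      (abs_nonneg _) (hmax q hqΩ) hsq hdecay
    exact small (by rw [h0]; positivity)

/-- The maximum principle for `∂h / z ^ k` on the perforated annulus, where the boundary
contribution of the holes is absorbed. -/
theorem norm_complexGradient_le_perforatedAnnulus {n : ℕ} {c : Fin n → ℂ} {h : ℂ → ℝ}
    {ρ T m Λ G E : ℝ} {k : ℕ}
    (hsep : ∀ i j, i ≠ j → 102 ≤ ‖c i - c j‖) (hc : ∀ j, 3 < ‖c j‖) (hρ : 0 < ρ) (hT : 0 < T)
    (hk : 8 * T ≤ k) (hΛ : 1 ≤ Λ) (hm0 : 0 ≤ m)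
    (hharm : ∀ z ∈ perforatedAnnulus c ρ T, HarmonicAt h z)
    (hm : ∀ z, ‖z‖ ≤ ρ → (∀ j, 3 < ‖z - c j‖) → |h z| ≤ m)
    (hH : ∀ z j, ‖z‖ ≤ T → ‖z - c j‖ ≤ 7 / 2 → ∀ p q, 3 ≤ ‖p - c j‖ → ‖p - c j‖ ≤ 7 / 2 →
      3 ≤ ‖q - c j‖ → ‖q - c j‖ ≤ 7 / 2 → |h p| ≤ Λ * |h q|)
    (hdecay : Λ ^ 2 * (1 - 7 / (T + 7)) ^ k < 1)
    (hG : ∀ z ∈ perforatedAnnulus c ρ T, ‖z‖ = ρ → ‖complexGradient h z‖ ≤ G)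
    (hE : ∀ z ∈ perforatedAnnulus c ρ T, ‖z‖ = T → ‖complexGradient h z‖ ≤ E)
    (hb : ∀ z ∈ perforatedAnnulus c ρ T, ∀ j, ‖z - c j‖ = 7 / 2 →
      ‖complexGradient h z‖ ≤ 4 * |h z|) :
    ∀ z ∈ perforatedAnnulus c ρ T, ‖complexGradient h z‖ ≤
      max (max (G / ρ ^ k) (E / T ^ k)) (4 * (Λ * m / ρ ^ k)) * ‖z‖ ^ k := by
  have hkpos : (0 : ℝ) < k := by linarith
  set Ω := perforatedAnnulus c ρ T with hΩ
  intro w hw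
  have hpos : ∀ z ∈ Ω, 0 < ‖z‖ := fun z hz => hρ.trans_le hz.1
  set f : ℂ → ℂ := fun z => complexGradient h z / z ^ k with hf
  have hfd : ∀ z ∈ Ω, DifferentiableAt ℂ f z := fun z hz =>
    (HarmonicAt.differentiableAt_complex_partial (hharm z hz)).div (by fun_prop)
      (pow_ne_zero _ (norm_pos_iff.1 (hpos z hz)))
  have hfc : ContinuousOn f Ω := fun z hz => (hfd z hz).continuousAt.continuousWithinAt
  have hfn : ∀ z, ‖f z‖ = ‖complexGradient h z‖ / ‖z‖ ^ k := fun z => by simp [hf]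
  obtain ⟨z₀, hz₀, hmax⟩ := (isCompact_perforatedAnnulus c ρ T).exists_isMaxOn ⟨w, hw⟩ hfc.norm
  set A := ‖f z₀‖ with hAdef
  have hA0 : 0 ≤ A := norm_nonneg _
  have hA : ∀ z ∈ Ω, ‖complexGradient h z‖ ≤ A * ‖z‖ ^ k := fun z hz => by
    rw [← div_le_iff₀ (pow_pos (hpos z hz) k), ← hfn]
    exact hmax hz
  set B := max (max (G / ρ ^ k) (E / T ^ k)) (4 * (Λ * m / ρ ^ k))
  suffices hAB : A ≤ B by
    exact (hA w hw).trans (mul_le_mul_of_nonneg_right hAB (by positivity))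
  have hB0 : 0 ≤ B := le_max_of_le_right (by positivity)
  have hhA := abs_le_of_norm_complexGradient_le hsep hc hρ (by exact_mod_cast hkpos) hΛ hm0
    (fun z hz => (hharm z hz).1.differentiableAt two_ne_zero) hm hH hdecay hA
  set V : Set ℂ := {z | ρ < ‖z‖ ∧ ‖z‖ < T ∧ ∀ j, 7 / 2 < ‖z - c j‖} with hV
  have hVΩ : V ⊆ Ω := fun z hz => ⟨hz.1.le, hz.2.1.le, fun j => (hz.2.2 j).le⟩
  have hVopen : IsOpen V := by
    have : V = {z | ρ < ‖z‖} ∩ ({z | ‖z‖ < T} ∩ ⋂ j, {z | 7 / 2 < ‖z - c j‖}) := by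
      ext z; simp [hV]
    rw [this]
    exact (isOpen_lt (by fun_prop) (by fun_prop)).inter
      ((isOpen_lt (by fun_prop) (by fun_prop)).inter
        (isOpen_iInter_of_finite fun j => isOpen_lt (by fun_prop) (by fun_prop)))
  have hclos : closure V ⊆ Ω := closure_minimal hVΩ (isClosed_perforatedAnnulus c ρ T)
  have hbdry : ∀ z ∈ Ω, z ∉ V → ‖f z‖ ≤ max B (A / 2) := by
    intro z hz hzV
    rw [hfn]
    rcases hz.1.eq_or_lt with h1 | h1
    · refine le_max_of_le_left (le_max_of_le_left (le_max_of_le_left ?_))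
      rw [← h1]
      have := hG z hz h1.symm
      gcongr
    rcases hz.2.1.eq_or_lt with h2 | h2
    · refine le_max_of_le_left (le_max_of_le_left (le_max_of_le_right ?_))
      rw [h2]
      have := hE z hz h2
      gcongr
    obtain ⟨j, hj⟩ : ∃ j, ‖z - c j‖ = 7 / 2 := by
      by_contra hcon
      push Not at hcon
      exact hzV ⟨h1, h2, fun j => lt_of_le_of_ne (hz.2.2 j) (hcon j).symm⟩
    rw [div_le_iff₀ (pow_pos (hpos z hz) k)]
    refine (hb z hz j hj).trans ?_
    calc 4 * |h z| ≤ 4 * (max (Λ * m / ρ ^ k) (T / k * A) * ‖z‖ ^ k) := by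
          gcongr; exact hhA z hz
      _ = max (4 * (Λ * m / ρ ^ k)) (4 * (T / k * A)) * ‖z‖ ^ k := by
          rw [← mul_assoc, mul_max_of_nonneg _ _ (by norm_num)]
      _ ≤ _ := by
          gcongr ?_ * _
          refine max_le_max (le_max_right _ _) ?_
          have : T / k ≤ 1 / 8 := by rw [div_le_div_iff₀ hkpos (by norm_num)]; linarith
          nlinarith
  have hmain : A ≤ max B (A / 2) := by
    by_cases hz₀V : z₀ ∈ V
    · refine norm_le_of_forall_mem_frontier_norm_le
        ((isCompact_perforatedAnnulus c ρ T).isBounded.subset hVΩ) ?_ ?_ (subset_closure hz₀V)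
      · exact ⟨fun z hz => (hfd z (hVΩ hz)).differentiableWithinAt, hfc.mono hclos⟩
      · intro z hz
        refine hbdry z (hclos (frontier_subset_closure hz)) fun hzV => ?_
        rw [hVopen.frontier_eq] at hz
        exact hz.2 hzV
    · exact hbdry z₀ hz₀ hz₀V
  rcases le_max_iff.1 hmain with h1 | h1
  · exact h1
  · linarith

theorem abs_le_perforatedAnnulus {n : ℕ} {c : Fin n → ℂ} {h : ℂ → ℝ}
    {ρ T m Λ G E : ℝ} {k : ℕ}
    (hsep : ∀ i j, i ≠ j → 102 ≤ ‖c i - c j‖) (hc : ∀ j, 3 < ‖c j‖) (hρ : 0 < ρ) (hT : 0 < T)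
    (hk : 8 * T ≤ k) (hΛ : 1 ≤ Λ) (hm0 : 0 ≤ m) (hG0 : 0 ≤ G) (hE0 : 0 ≤ E)
    (hharm : ∀ z ∈ perforatedAnnulus c ρ T, HarmonicAt h z)
    (hm : ∀ z, ‖z‖ ≤ ρ → (∀ j, 3 < ‖z - c j‖) → |h z| ≤ m)
    (hH : ∀ z j, ‖z‖ ≤ T → ‖z - c j‖ ≤ 7 / 2 → ∀ p q, 3 ≤ ‖p - c j‖ → ‖p - c j‖ ≤ 7 / 2 →
      3 ≤ ‖q - c j‖ → ‖q - c j‖ ≤ 7 / 2 → |h p| ≤ Λ * |h q|)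
    (hdecay : Λ ^ 2 * (1 - 7 / (T + 7)) ^ k < 1)
    (hG : ∀ z ∈ perforatedAnnulus c ρ T, ‖z‖ = ρ → ‖complexGradient h z‖ ≤ G)
    (hE : ∀ z ∈ perforatedAnnulus c ρ T, ‖z‖ = T → ‖complexGradient h z‖ ≤ E)
    (hb : ∀ z ∈ perforatedAnnulus c ρ T, ∀ j, ‖z - c j‖ = 7 / 2 →
      ‖complexGradient h z‖ ≤ 4 * |h z|) :
    ∀ z ∈ perforatedAnnulus c ρ T,
      |h z| ≤ ((Λ * m + G) / ρ ^ k + E / T ^ k) * ‖z‖ ^ k := by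
  have hkpos : (0 : ℝ) < k := by linarith
  intro z hz
  have h1 := abs_le_of_norm_complexGradient_le hsep hc hρ (by exact_mod_cast hkpos) hΛ hm0
    (fun z hz => (hharm z hz).1.differentiableAt two_ne_zero) hm hH hdecay
    (norm_complexGradient_le_perforatedAnnulus hsep hc hρ hT hk hΛ hm0 hharm hm hH hdecay hG hE hb)
    z hz
  refine h1.trans (mul_le_mul_of_nonneg_right ?_ (by positivity))
  have hX : 0 ≤ Λ * m / ρ ^ k := by positivity
  have hY : 0 ≤ G / ρ ^ k := by positivity
  have hZ : 0 ≤ E / T ^ k := by positivity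
  rw [add_div]
  have hTk : T / k ≤ 1 / 8 := by rw [div_le_div_iff₀ hkpos (by norm_num)]; linarith
  refine max_le (by linarith) ?_
  have hle : max (max (G / ρ ^ k) (E / T ^ k)) (4 * (Λ * m / ρ ^ k)) ≤
      4 * (Λ * m / ρ ^ k + G / ρ ^ k + E / T ^ k) :=
    max_le (max_le (by linarith) (by linarith)) (by linarith)
  calc _ ≤ 1 / 8 * (4 * (Λ * m / ρ ^ k + G / ρ ^ k + E / T ^ k)) := by gcongr
    _ ≤ _ := by linarith

theorem laplacian_eq_planeLaplacian {h : ℂ → ℝ} {z : ℂ} (hh : ContDiffAt ℝ 2 h z) :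
    Laplacian.laplacian h z = planeLaplacian h z := by
  have hd : DifferentiableAt ℝ (fderiv ℝ h) z :=
    (hh.fderiv_right (m := 1) (by norm_num)).differentiableAt one_ne_zero
  have e : ∀ v : ℂ, fderiv ℝ (fun w => fderiv ℝ h w v) z v = fderiv ℝ (fderiv ℝ h) z v v := by
    intro v
    rw [fderiv_clm_apply hd (by fun_prop)]
    simp
  rw [laplacian_eq_iteratedFDeriv_complexPlane, planeLaplacian, e, e]
  simp [iteratedFDeriv_two_apply]

theorem harmonicOnNhd_of_planeLaplacian_eq_zero {h : ℂ → ℝ} {U : Set ℂ} (hU : IsOpen U)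
    (hh : ContDiffOn ℝ 2 h U) (h0 : ∀ z ∈ U, planeLaplacian h z = 0) : HarmonicOnNhd h U := by
  intro z hz
  refine ⟨hh.contDiffAt (hU.mem_nhds hz), ?_⟩
  filter_upwards [hU.mem_nhds hz] with w hw
  rw [laplacian_eq_planeLaplacian (hh.contDiffAt (hU.mem_nhds hw)), h0 w hw]
  rfl

theorem abs_le_of_harmonic_punctured {n : ℕ} {c : Fin n → ℂ} {h : ℂ → ℝ}
    {R T T' ρ m N : ℝ} {k : ℕ}
    (hsep : ∀ i j, i ≠ j → 102 ≤ ‖c i - c j‖) (hc : ∀ j, 3 < ‖c j‖)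
    (hharm : HarmonicOnNhd h (ball (0 : ℂ) R \ ⋃ j, closedBall (c j) 1))
    (hsign : ∀ j, (∀ z ∈ (closedBall (c j) 5 \ closedBall (c j) 1) ∩ ball (0 : ℂ) R, 0 ≤ h z) ∨
      (∀ z ∈ (closedBall (c j) 5 \ closedBall (c j) 1) ∩ ball (0 : ℂ) R, h z ≤ 0))
    (hρ : 0 < ρ) (hρT : ρ ≤ T') (hTT : T' ≤ T) (hTR : T + 15 / 2 < R) (hk : 40 * R ≤ k)
    (hm0 : 0 ≤ m) (hN0 : 0 ≤ N)
    (hN : ∀ z, ‖z‖ < R → (∀ j, 3 < ‖z - c j‖) → |h z| ≤ N)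
    (hm : ∀ z, ‖z‖ < 2 * ρ → (∀ j, 3 < ‖z - c j‖) → |h z| ≤ m)
    {z : ℂ} (hz : ‖z‖ ≤ T') (hzc : ∀ j, 3 < ‖z - c j‖) :
    |h z| ≤ Real.exp 112 * (((Real.exp 112 * m + 4 * m / min ρ (1 / 2)) / ρ ^ k
      + 8 * N / T ^ k) * T' ^ k) := by
  set Λ := Real.exp 112
  have hΛ : 1 ≤ Λ := Real.one_le_exp (by norm_num)
  have hT' : 0 < T' := hρ.trans_le hρT
  have hT : 0 < T := hT'.trans_le hTT
  have tri : ∀ a b d : ℂ, ‖a - d‖ ≤ ‖a - b‖ + ‖b - d‖ := norm_sub_le_norm_sub_add_norm_sub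
  have tri0 : ∀ a b : ℂ, ‖a‖ ≤ ‖a - b‖ + ‖b‖ := fun a b => by simpa using tri a b 0
  have hG0 : 0 ≤ 4 * m / min ρ (1 / 2) := by positivity
  have mem_U : ∀ w, ‖w‖ < R → (∀ j, 1 < ‖w - c j‖) →
      w ∈ ball (0 : ℂ) R \ ⋃ j, closedBall (c j) 1 := fun w hw hwj => by
    simpa [dist_eq_norm, hw] using hwj
  have mem_A : ∀ j w, ‖w‖ < R → 1 < ‖w - c j‖ → ‖w - c j‖ ≤ 5 →
      w ∈ (closedBall (c j) 5 \ closedBall (c j) 1) ∩ ball (0 : ℂ) R := fun j w h1 h2 h3 => by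
    simp [dist_eq_norm, h1, h2, h3]
  have ball_far : ∀ p, ‖p‖ ≤ T → (∀ j, 7 / 2 ≤ ‖p - c j‖) → ∀ w ∈ ball p (1 / 2),
      ‖w‖ < R ∧ ∀ j, 3 < ‖w - c j‖ := fun p hp hpc w hw => by
    rw [mem_ball, dist_eq_norm] at hw
    refine ⟨by linarith [tri0 w p], fun j => ?_⟩
    have := tri p w (c j)
    rw [norm_sub_rev p w] at this
    linarith [hpc j]
  have ball_near : ∀ z j, ‖z‖ ≤ T → ‖z - c j‖ ≤ 7 / 2 → ∀ p, 3 ≤ ‖p - c j‖ → ‖p - c j‖ ≤ 7 / 2 →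
      ∀ w ∈ ball p (1 / 2), ‖w‖ < R ∧ 1 < ‖w - c j‖ ∧ ‖w - c j‖ ≤ 5 ∧ ∀ i, 1 < ‖w - c i‖ := by
    intro z j hz hzj p hp3 hp7 w hw
    rw [mem_ball, dist_eq_norm] at hw
    have h1 := tri0 w p
    have h2 := tri0 p z
    have h3 := tri p (c j) z
    rw [norm_sub_rev (c j) z] at h3
    have h4 := tri w p (c j)
    have h5 : ∀ i, ‖p - c i‖ ≤ ‖w - p‖ + ‖w - c i‖ := fun i => by
      have := tri p w (c i)
      rwa [norm_sub_rev p w] at this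
    have h6 : 1 < ‖w - c j‖ := by linarith [h5 j]
    refine ⟨by linarith, h6, by linarith, fun i => ?_⟩
    by_cases hij : i = j
    · rwa [hij]
    · linarith [h5 i, lt_norm_sub_of_separated hsep hij hp7]
  have near_harm : ∀ z j, ‖z‖ ≤ T → ‖z - c j‖ ≤ 7 / 2 → ∀ p, 3 ≤ ‖p - c j‖ →
      ‖p - c j‖ ≤ 7 / 2 → HarmonicOnNhd h (ball p (1 / 2)) := fun z j h1 h2 p h3 h4 =>
    hharm.mono fun w hw => by
      obtain ⟨g1, -, -, g4⟩ := ball_near z j h1 h2 p h3 h4 w hw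
      exact mem_U w g1 g4
  have near_sign : ∀ z j, ‖z‖ ≤ T → ‖z - c j‖ ≤ 7 / 2 →
      (∀ p, 3 ≤ ‖p - c j‖ → ‖p - c j‖ ≤ 7 / 2 → ∀ w ∈ ball p (1 / 2), 0 ≤ h w) ∨
      (∀ p, 3 ≤ ‖p - c j‖ → ‖p - c j‖ ≤ 7 / 2 → ∀ w ∈ ball p (1 / 2), h w ≤ 0) := by
    intro z j h1 h2
    refine (hsign j).imp (fun hs p h3 h4 w hw => ?_) (fun hs p h3 h4 w hw => ?_) <;>
    · obtain ⟨g1, g2, g3, -⟩ := ball_near z j h1 h2 p h3 h4 w hw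
      exact hs w (mem_A j w g1 g2 g3)
  have hH : ∀ z j, ‖z‖ ≤ T → ‖z - c j‖ ≤ 7 / 2 → ∀ p q, 3 ≤ ‖p - c j‖ → ‖p - c j‖ ≤ 7 / 2 →
      3 ≤ ‖q - c j‖ → ‖q - c j‖ ≤ 7 / 2 → |h p| ≤ Λ * |h q| := fun z j h1 h2 p q hp hp' hq hq' =>
    harnack_annulus (near_harm z j h1 h2) (near_sign z j h1 h2) hp hp' hq hq'
  have far_harm : ∀ p, ‖p‖ ≤ T → (∀ j, 7 / 2 ≤ ‖p - c j‖) →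
      HarmonicOnNhd h (ball p (1 / 2)) := fun p h1 h2 => hharm.mono fun w hw => by
    obtain ⟨g1, g2⟩ := ball_far p h1 h2 w hw
    exact mem_U w g1 fun j => by linarith [g2 j]
  have hm' : ∀ w, ‖w‖ ≤ ρ → (∀ j, 3 < ‖w - c j‖) → |h w| ≤ m := fun w hw => hm w (by linarith)
  have hdecay : Λ ^ 2 * (1 - 7 / (T + 7)) ^ k < 1 := by
    have e : 1 - 7 / (T + 7) = T / (T + 7) := by field_simp; ring
    have h0 : 0 ≤ 1 - 7 / (T + 7) := by rw [e]; positivity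
    have h1 : (1 - 7 / (T + 7)) ^ k ≤ Real.exp (-(7 / (T + 7))) ^ k :=
      pow_le_pow_left₀ h0 (Real.one_sub_le_exp_neg _) k
    have h2 : (280 : ℝ) ≤ k * (7 / (T + 7)) := by
      rw [← mul_div_assoc, le_div_iff₀ (by linarith)]
      linarith
    calc Λ ^ 2 * (1 - 7 / (T + 7)) ^ k ≤ Real.exp 112 ^ 2 * Real.exp (-(7 / (T + 7))) ^ k := by
          gcongr
      _ = Real.exp (224 - k * (7 / (T + 7))) := by
          rw [← Real.exp_nat_mul, ← Real.exp_nat_mul, ← Real.exp_add]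
          congr 1; push_cast; ring
      _ < 1 := by rw [Real.exp_lt_one_iff]; linarith
  have main := abs_le_perforatedAnnulus (ρ := ρ) (T := T) (m := m) (Λ := Λ)
    (G := 4 * m / min ρ (1 / 2)) (E := 8 * N) (k := k) (h := h) hsep hc hρ hT (by linarith) hΛ hm0
    hG0 (by positivity)
    (fun p hp => far_harm p hp.2.1 hp.2.2 p (mem_ball_self (by norm_num))) hm' hH hdecay
    (fun p hp hpρ => by
      refine norm_complexGradient_le_of_abs_le (lt_min hρ (by norm_num))
        ((far_harm p hp.2.1 hp.2.2).mono (ball_subset_ball (min_le_right _ _))) fun w hw => ?_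
      refine hm w ?_ (ball_far p hp.2.1 hp.2.2 w (ball_subset_ball (min_le_right _ _) hw)).2
      rw [mem_ball, dist_eq_norm] at hw
      linarith [tri0 w p, min_le_left ρ (1 / 2)])
    (fun p hp hpT => by
      refine (norm_complexGradient_le_of_abs_le (by norm_num) (far_harm p hp.2.1 hp.2.2)
        fun w hw => ?_).trans (b := 4 * N / (1 / 2)) (by linarith)
      obtain ⟨g1, g2⟩ := ball_far p hp.2.1 hp.2.2 w hw
      exact hN w g1 g2)
    (fun p hp j hpj => by
      refine (norm_complexGradient_le_of_sign (by norm_num) (far_harm p hp.2.1 hp.2.2)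
        ((near_sign p j hp.2.1 hpj.le).imp (fun hs => hs p (by linarith) hpj.le)
          (fun hs => hs p (by linarith) hpj.le))).trans (b := 2 * |h p| / (1 / 2)) (by linarith))
  set Q := ((Λ * m + 4 * m / min ρ (1 / 2)) / ρ ^ k + 8 * N / T ^ k) with hQ
  have hQ0 : 0 ≤ Q := by positivity
  have main' : ∀ q, ‖q‖ ≤ T' → (∀ j, 7 / 2 ≤ ‖q - c j‖) → ρ ≤ ‖q‖ → |h q| ≤ Q * T' ^ k :=
    fun q hq hqc hqρ => (main q ⟨hqρ, hq.trans hTT, hqc⟩).trans (by gcongr)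
  have hmQ : m ≤ Q * T' ^ k := by
    calc m ≤ Λ * m := le_mul_of_one_le_left hm0 hΛ
      _ = Λ * m / ρ ^ k * ρ ^ k := by field_simp
      _ ≤ Q * T' ^ k := by
        gcongr
        rw [hQ, add_div]
        have : 0 ≤ 4 * m / min ρ (1 / 2) / ρ ^ k := by positivity
        have : 0 ≤ 8 * N / T ^ k := by positivity
        linarith
  have hpos : 0 ≤ Q * T' ^ k := by positivity
  rcases le_total ‖z‖ ρ with hzρ | hzρ
  · exact (hm' z hzρ hzc).trans (hmQ.trans (le_mul_of_one_le_left hpos hΛ))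
  by_cases hfar : ∀ j, 7 / 2 ≤ ‖z - c j‖
  · exact (main' z hz hfar hzρ).trans (le_mul_of_one_le_left hpos hΛ)
  push Not at hfar
  obtain ⟨j, hj⟩ := hfar
  obtain ⟨q, hq3, hq7, hq⟩ := exists_inner_point_annulus (hc j)
  refine (hH z j (hz.trans hTT) hj.le z q (hzc j).le hj.le hq3 hq7).trans ?_
  refine mul_le_mul_of_nonneg_left ?_ (by linarith)
  rcases hq with rfl | ⟨hqc, hqn⟩
  · exact (hm' 0 (by simpa using hρ.le) fun i => by simpa using hc i).trans hmQ
  have hqsep : ∀ i, 7 / 2 ≤ ‖q - c i‖ := fun i => by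
    by_cases hij : i = j
    · rw [hij, hqc]
    · linarith [lt_norm_sub_of_separated hsep hij hq7]
  rcases le_total ‖q‖ ρ with hqρ | hqρ
  · exact (hm' q hqρ fun i => by linarith [hqsep i]).trans hmQ
  · refine main' q ?_ hqsep hqρ
    have := tri0 (c j) z
    rw [norm_sub_rev] at this
    linarith

/-- Absorbing the absolute constants into the power of `X = R / ρ`. -/
theorem le_mul_pow_of_growth {R T T' ρ m P M : ℝ} {k : ℕ} (hR : 1 ≤ R) (hρ : 0 < ρ)
    (hX : 2 ^ 11 ≤ R / ρ) (hT' : 0 < T') (hTT : T' = T - R / 4096) (hTR : T ≤ R) (hm0 : 0 ≤ m)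
    (hP0 : 0 ≤ P) (hk : 226 ≤ k) (hkM : 4096 * (M + 116) ≤ k)
    (hP : P ≤ Real.exp 112 * (((Real.exp 112 * m + 4 * m / min ρ (1 / 2)) / ρ ^ k
      + 8 * (Real.exp M * P) / T ^ k) * T' ^ k)) :
    P ≤ (R / ρ) ^ (2 * k) * m := by
  set Λ := Real.exp 112 with hΛdef
  set X := R / ρ with hXdef
  have hT : 0 < T := by linarith
  have hΛ : 8 ≤ Λ := by
    have := Real.add_one_le_exp (112 : ℝ)
    linarith
  have hX1 : (1 : ℝ) ≤ X := by linarith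
  have hT'R : T' ≤ R := by linarith
  have hout : Λ * (8 * (Real.exp M * P) / T ^ k * T' ^ k) ≤ P / 2 := by
    have h1 : T' / T ≤ Real.exp (-(1 / 4096)) := by
      refine le_trans ?_ (Real.one_sub_le_exp_neg _)
      rw [div_le_iff₀ hT]
      linarith
    have h2 : (T' / T) ^ k ≤ Real.exp (-(M + 116)) := by
      calc (T' / T) ^ k ≤ Real.exp (-(1 / 4096)) ^ k := pow_le_pow_left₀ (by positivity) h1 k
        _ = Real.exp (k * -(1 / 4096)) := by rw [← Real.exp_nat_mul]
        _ ≤ _ := by gcongr; linarith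
    have h3 : Real.exp (-4) ≤ 1 / 16 := by
      rw [Real.exp_neg, ← one_div]
      refine one_div_le_one_div_of_le (by norm_num) ?_
      have h5 : Real.exp 4 = Real.exp 1 ^ 4 := by rw [← Real.exp_nat_mul]; norm_num
      have h6 : (2 : ℝ) ≤ Real.exp 1 := by linarith [Real.add_one_le_exp (1 : ℝ)]
      rw [h5]
      calc (16 : ℝ) = 2 ^ 4 := by norm_num
        _ ≤ _ := by gcongr
    calc Λ * (8 * (Real.exp M * P) / T ^ k * T' ^ k)
        = 8 * P * (Λ * Real.exp M * (T' / T) ^ k) := by rw [div_pow]; ring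
      _ ≤ 8 * P * (Λ * Real.exp M * Real.exp (-(M + 116))) := by gcongr
      _ = 8 * P * Real.exp (-4) := by
          rw [hΛdef, ← Real.exp_add, ← Real.exp_add]; congr 2; ring
      _ ≤ 8 * P * (1 / 16) := by gcongr
      _ = P / 2 := by ring
  have hmin : 4 / min ρ (1 / 2) ≤ 4 * X := by
    rcases min_choice ρ (1 / 2) with h | h <;> rw [h]
    · rw [hXdef, div_le_iff₀ hρ, mul_assoc, div_mul_cancel₀ _ hρ.ne']; linarith
    · norm_num; linarith
  have hin : Λ * ((Λ * m + 4 * m / min ρ (1 / 2)) / ρ ^ k * T' ^ k) ≤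
      Λ * (Λ + 4 * X) * m * X ^ k := by
    have h1 : (T' / ρ) ^ k ≤ X ^ k := by rw [hXdef]; gcongr
    calc Λ * ((Λ * m + 4 * m / min ρ (1 / 2)) / ρ ^ k * T' ^ k)
        = Λ * (Λ + 4 / min ρ (1 / 2)) * m * (T' / ρ) ^ k := by rw [div_pow]; ring
      _ ≤ _ := by gcongr
  have hconst : 2 * (Λ * (Λ + 4 * X)) ≤ X ^ k := by
    have h1 : Λ + 4 * X ≤ Λ * X := by nlinarith
    have hexp : Λ ^ 2 ≤ X ^ 224 := by
      have h5 : Λ ^ 2 = Real.exp 1 ^ 224 := by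
        rw [hΛdef, ← Real.exp_nat_mul, ← Real.exp_nat_mul]; norm_num
      rw [h5]
      have := Real.exp_one_lt_d9
      gcongr
      linarith
    calc 2 * (Λ * (Λ + 4 * X)) ≤ X * (Λ * (Λ * X)) := by gcongr; linarith
      _ = Λ ^ 2 * X ^ 2 := by ring
      _ ≤ X ^ 224 * X ^ 2 := by gcongr
      _ = X ^ 226 := by rw [← pow_add]
      _ ≤ X ^ k := pow_le_pow_right₀ hX1 hk
  have hfin : Λ * (Λ + 4 * X) * m * X ^ k ≤ X ^ k / 2 * m * X ^ k := by
    gcongr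
    linarith
  have e : X ^ (2 * k) * m = 2 * (X ^ k / 2 * m * X ^ k) := by ring
  rw [add_mul, mul_add] at hP
  rw [e]
  linarith

theorem rpow_mul_pow_le_one {X K : ℝ} {k : ℕ} (hX : 2 ^ 10 ≤ X) (hK : 4 * (k : ℝ) ≤ K) :
    (32 / X) ^ K * X ^ (2 * k) ≤ 1 := by
  have hX0 : 0 < X := by linarith
  have hK0 : 0 ≤ K := le_trans (by positivity) hK
  have h1 : 32 / X ≤ X ^ (-(1 / 2) : ℝ) := by
    rw [Real.rpow_neg hX0.le, ← Real.sqrt_eq_rpow, ← one_div,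
      div_le_div_iff₀ hX0 (Real.sqrt_pos.2 hX0)]
    have h32 : 32 ≤ Real.sqrt X := Real.le_sqrt_of_sq_le (by linarith)
    nlinarith [Real.mul_self_sqrt hX0.le]
  calc (32 / X) ^ K * X ^ (2 * k) ≤ (X ^ (-(1 / 2) : ℝ)) ^ K * X ^ ((2 * k : ℕ) : ℝ) := by
        rw [Real.rpow_natCast]; gcongr
    _ = X ^ (-(1 / 2) * K + ((2 * k : ℕ) : ℝ)) := by
        rw [← Real.rpow_mul hX0.le, ← Real.rpow_add hX0]
    _ ≤ 1 := Real.rpow_le_one_of_one_le_of_nonpos (by linarith) (by push_cast; linarith)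

/-- Proposition 2.2 (quantitative unique continuation for harmonic functions in
punctured domains): there exist `C_H ≥ 10` and a universal `C₂ > 0` such that for
any finite collection of `100`-separated closed unit disks `D_j = closedBall (c j) 1`
(centers `102`-separated) with `0 ∉ ∪ 3D_j`, any `R ≥ 2^{10}`, and any real
harmonic function `h` on `B(0,R) ∖ ∪ D_j` which does not change sign in
`(5D_j ∖ D_j) ∩ B(0,R)` for each `j`: if `S ∈ [R/4, R/2]`, `M > 0`, and
`sup_{B(0,R−S/32) ∖ ∪3D_j} |h| ≥ e^{−M} sup_{B(0,R) ∖ ∪3D_j} |h|` (expressed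
pointwise), then for all `r ∈ (0, R/2^{10})`,
`sup_{B(0,r) ∖ ∪3D_j} |h| ≥ (16r/R)^{K(R,M)} sup_{B(0,R−S/32) ∖ ∪3D_j} |h|`,
where `K(R,M) = max{6C_H R, C₂ M}`. -/
theorem harmonic_punctured_ucp :
    ∃ C_H : ℝ, 10 ≤ C_H ∧ ∃ C₂ > (0:ℝ),
      ∀ (n : ℕ) (c : Fin n → ℂ) (R : ℝ) (h : ℂ → ℝ),
      (∀ i j : Fin n, i ≠ j → 102 ≤ dist (c i) (c j)) →
      ((0:ℂ) ∉ ⋃ j, Metric.closedBall (c j) 3) →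
      2 ^ 10 ≤ R →
      ContDiffOn ℝ 2 h (Metric.ball (0:ℂ) R \ ⋃ j, Metric.closedBall (c j) 1) →
      (∀ z ∈ Metric.ball (0:ℂ) R \ ⋃ j, Metric.closedBall (c j) 1,
        planeLaplacian h z = 0) →
      (∀ j : Fin n,
        (∀ z ∈ (Metric.closedBall (c j) 5 \ Metric.closedBall (c j) 1) ∩ Metric.ball (0:ℂ) R,
          0 ≤ h z) ∨
        (∀ z ∈ (Metric.closedBall (c j) 5 \ Metric.closedBall (c j) 1) ∩ Metric.ball (0:ℂ) R,
          h z ≤ 0)) →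
      ∀ S M : ℝ, R / 4 ≤ S → S ≤ R / 2 → 0 < M →
      (∀ z ∈ Metric.ball (0:ℂ) R \ ⋃ j, Metric.closedBall (c j) 3,
        |h z| ≤ Real.exp M *
          sSup ((fun z => |h z|) ''
            (Metric.ball (0:ℂ) (R - S / 32) \ ⋃ j, Metric.closedBall (c j) 3))) →
      ∀ r : ℝ, 0 < r → r < R / 2 ^ 10 →
        (16 * r / R) ^ (max (6 * C_H * R) (C₂ * M)) *
            sSup ((fun z => |h z|) ''
              (Metric.ball (0:ℂ) (R - S / 32) \ ⋃ j, Metric.closedBall (c j) 3))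
          ≤ sSup ((fun z => |h z|) ''
              (Metric.ball (0:ℂ) r \ ⋃ j, Metric.closedBall (c j) 3)) := by
  refine ⟨1000, by norm_num, 40000, by norm_num, ?_⟩
  intro n c R h hsep hc hR hcd hlap hsign S M hS hS' hM hgrow r hr hrR
  have hsep' : ∀ i j, i ≠ j → 102 ≤ ‖c i - c j‖ := fun i j hij => by
    simpa [dist_eq_norm] using hsep i j hij
  have hc' : ∀ j, 3 < ‖c j‖ := by simpa using hc
  have hU : IsOpen (ball (0 : ℂ) R \ ⋃ j, closedBall (c j) 1) :=
    isOpen_ball.sdiff (isClosed_iUnion_of_finite fun _ => isClosed_closedBall)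
  have hharm := harmonicOnNhd_of_planeLaplacian_eq_zero hU hcd hlap
  have mem_iff : ∀ (s : ℝ) (z : ℂ), z ∈ ball (0 : ℂ) s \ ⋃ j, closedBall (c j) 3 ↔
      ‖z‖ < s ∧ ∀ j, 3 < ‖z - c j‖ := fun s z => by simp [dist_eq_norm]
  simp only [mem_iff, and_imp] at hgrow
  set P := sSup ((fun z => |h z|) ''
    (ball (0 : ℂ) (R - S / 32) \ ⋃ j, closedBall (c j) 3)) with hPdef
  set m := sSup ((fun z => |h z|) '' (ball (0 : ℂ) r \ ⋃ j, closedBall (c j) 3)) with hmdef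
  have hP0 : 0 ≤ P := Real.sSup_nonneg (by rintro _ ⟨z, -, rfl⟩; exact abs_nonneg _)
  have hm0 : 0 ≤ m := Real.sSup_nonneg (by rintro _ ⟨z, -, rfl⟩; exact abs_nonneg _)
  have hm : ∀ z, ‖z‖ < 2 * (r / 2) → (∀ j, 3 < ‖z - c j‖) → |h z| ≤ m := by
    intro z hz hzc
    refine le_csSup ⟨Real.exp M * P, ?_⟩ ⟨z, (mem_iff r z).2 ⟨by linarith, hzc⟩, rfl⟩
    rintro _ ⟨w, hw, rfl⟩
    obtain ⟨hw1, hw2⟩ := (mem_iff r w).1 hw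
    exact hgrow w (by linarith) hw2
  set K := max (6 * 1000 * R) (40000 * M)
  have hKR : 6 * 1000 * R ≤ K := le_max_left _ _
  have hKM : 40000 * M ≤ K := le_max_right _ _
  set k := ⌊K / 4⌋₊
  have hk1 : (k : ℝ) ≤ K / 4 := Nat.floor_le (by linarith)
  have hk2 : K / 4 < k + 1 := Nat.lt_floor_add_one _
  have hPle : P ≤ (R / (r / 2)) ^ (2 * k) * m := by
    refine le_mul_pow_of_growth (T := R - S / 32 + R / 4096) (T' := R - S / 32) (M := M)
      (by linarith) (by linarith) ?_ (by linarith) (by ring) (by linarith) hm0 hP0 ?_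
      (by linarith) ?_
    · rw [le_div_iff₀ (by linarith)]
      linarith
    · have : (226 : ℝ) ≤ k := by linarith
      exact_mod_cast this
    · refine csSup_le ⟨_, 0, (mem_iff _ _).2 ⟨?_, fun j => by simpa using hc' j⟩, rfl⟩ ?_
      · rw [norm_zero]; linarith
      · rintro _ ⟨z, hz, rfl⟩
        obtain ⟨hz1, hz2⟩ := (mem_iff _ z).1 hz
        exact abs_le_of_harmonic_punctured hsep' hc' hharm hsign (by linarith) (by linarith)
          (by linarith) (by linarith) (by linarith) hm0 (by positivity) hgrow hm hz1.le hz2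
  have e : 16 * r / R = 32 / (R / (r / 2)) := by
    field_simp
    norm_num
  have hX : 2 ^ 10 ≤ R / (r / 2) := by
    rw [le_div_iff₀ (by linarith)]
    linarith
  have hone := rpow_mul_pow_le_one hX (K := K) (k := k) (by linarith)
  rw [e]
  calc (32 / (R / (r / 2))) ^ K * P
      ≤ (32 / (R / (r / 2))) ^ K * ((R / (r / 2)) ^ (2 * k) * m) := by gcongr
    _ = (32 / (R / (r / 2))) ^ K * (R / (r / 2)) ^ (2 * k) * m := by ring
    _ ≤ 1 * m := by gcongr
    _ = m := one_mul m
end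

section
/- Let β > 0 and c ≠ 0 be real numbers, and define u : ℝ² ∖ {0} → ℝ by u(z) = exp(c|z|^β). Then u satisfies Δu − Vu = 0 on ℝ² ∖ {0}, where V(z) = c β² (c|z|^β + 1) |z|^{β−2}; moreover |V(z)| ≤ |c| β² (|c| + 1) |z|^{2β−2} for all |z| ≥ 1. -/
theorem hasFDerivAt_norm_rpow_of_ne_zero {E : Type*} [NormedAddCommGroup E]
    [InnerProductSpace ℝ E] {x : E} (hx : x ≠ 0) (p : ℝ) :
    HasFDerivAt (fun y : E => ‖y‖ ^ p) ((p * ‖x‖ ^ (p - 2)) • innerSL ℝ x) x := by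
  have hpow (y : E) (q : ℝ) : (‖y‖ ^ 2) ^ q = ‖y‖ ^ (2 * q) := by
    rw [Real.rpow_mul (norm_nonneg y), Real.rpow_two]
  have h := (hasStrictFDerivAt_norm_sq x).hasFDerivAt.rpow_const (p := p / 2)
    (Or.inl (pow_ne_zero 2 (norm_ne_zero_iff.mpr hx)))
  simp only [hpow] at h
  convert h using 1
  · funext y
    ring_nf
  · ext v
    simp only [smul_apply, smul_eq_mul]
    ring_nf

theorem hasFDerivAt_exp_norm_rpow {E : Type*} [NormedAddCommGroup E]
    [InnerProductSpace ℝ E] {x : E} (hx : x ≠ 0) (β c : ℝ) :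
    HasFDerivAt (fun y : E => Real.exp (c * ‖y‖ ^ β))
      ((Real.exp (c * ‖x‖ ^ β) * (c * β * ‖x‖ ^ (β - 2))) • innerSL ℝ x) x := by
  convert ((hasFDerivAt_norm_rpow_of_ne_zero hx β).const_mul c).exp using 1
  simp only [smul_smul]
  ring_nf

open scoped RealInnerProductSpace in
theorem fderiv_fderiv_exp_norm_rpow {E : Type*} [NormedAddCommGroup E]
    [InnerProductSpace ℝ E] {x : E} (hx : x ≠ 0) (β c : ℝ) (v : E) :
    fderiv ℝ (fun y => fderiv ℝ (fun w : E => Real.exp (c * ‖w‖ ^ β)) y v) x v =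
      Real.exp (c * ‖x‖ ^ β) * (c * β) *
        ((c * β * (‖x‖ ^ (β - 2)) ^ 2 + (β - 2) * ‖x‖ ^ (β - 4)) * ⟪x, v⟫ ^ 2
          + ‖x‖ ^ (β - 2) * ‖v‖ ^ 2) := by
  have heq : (fun y => fderiv ℝ (fun w : E => Real.exp (c * ‖w‖ ^ β)) y v) =ᶠ[nhds x]
      fun y => Real.exp (c * ‖y‖ ^ β) * (c * β * ‖y‖ ^ (β - 2)) * innerSL ℝ v y := by
    filter_upwards [isOpen_ne.mem_nhds hx] with y hy
    simp [(hasFDerivAt_exp_norm_rpow hy β c).fderiv, real_inner_comm]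
  have h := ((hasFDerivAt_exp_norm_rpow hx β c).mul
    ((hasFDerivAt_norm_rpow_of_ne_zero hx (β - 2)).const_mul (c * β))).mul
    (innerSL ℝ v).hasFDerivAt
  rw [heq.fderiv_eq]
  refine (congrArg (fun L : E →L[ℝ] ℝ => L v) h.fderiv).trans ?_
  have h4 : β - 2 - 2 = β - 4 := by ring
  simp only [add_apply, smul_apply, Pi.mul_apply,
    innerSL_apply_apply, smul_eq_mul, real_inner_self_eq_norm_sq, real_inner_comm x v, h4]
  ring

/-- The sharpness example from Section 1: for `β > 0` and `c ≠ 0`, the function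
`u(z) = exp(c|z|^β)` satisfies `Δu − Vu = 0` on `ℝ² ∖ {0}` with
`V(z) = cβ²(c|z|^β + 1)|z|^{β−2}`, and `|V(z)| ≤ |c|β²(|c|+1)|z|^{2β−2}` for `|z| ≥ 1`. -/
theorem sharpness_example (β c : ℝ) (hβ : 0 < β) (hc : c ≠ 0) :
    (∀ z : ℂ, z ≠ 0 →
      planeLaplacian (fun w => Real.exp (c * ‖w‖ ^ β)) z
        = (c * β ^ 2 * (c * ‖z‖ ^ β + 1) * ‖z‖ ^ (β - 2)) * Real.exp (c * ‖z‖ ^ β)) ∧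
    (∀ z : ℂ, 1 ≤ ‖z‖ →
      |c * β ^ 2 * (c * ‖z‖ ^ β + 1) * ‖z‖ ^ (β - 2)|
        ≤ |c| * β ^ 2 * (|c| + 1) * ‖z‖ ^ (2 * β - 2)) := by
  refine ⟨fun z hz => ?_, fun z hz => ?_⟩
  · have hr : 0 < ‖z‖ := norm_pos_iff.mpr hz
    have hsq : inner ℝ z 1 ^ 2 + inner ℝ z Complex.I ^ 2 = ‖z‖ ^ 2 := by
      rw [Complex.sq_norm, Complex.normSq_apply]
      simp [Complex.inner, sq]
    have hpow (q : ℝ) : ‖z‖ ^ q = ‖z‖ ^ (q - 2) * ‖z‖ ^ 2 := by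
      rw [← Real.rpow_two, ← Real.rpow_add hr, sub_add_cancel]
    have h2 := hpow β
    have h4 := hpow (β - 2)
    rw [show β - 2 - 2 = β - 4 by ring] at h4
    rw [planeLaplacian, fderiv_fderiv_exp_norm_rpow hz, fderiv_fderiv_exp_norm_rpow hz]
    simp only [norm_one, Complex.norm_I]
    generalize Real.exp (c * ‖z‖ ^ β) = u
    rw [h2]
    linear_combination u * (c * β) *
      ((c * β * (‖z‖ ^ (β - 2)) ^ 2 + (β - 2) * ‖z‖ ^ (β - 4)) * hsq - (β - 2) * h4)
  · have hr : 0 < ‖z‖ := one_pos.trans_le hz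
    have hone : 1 ≤ ‖z‖ ^ β := Real.one_le_rpow hz hβ.le
    have hbound : |c * ‖z‖ ^ β + 1| ≤ (|c| + 1) * ‖z‖ ^ β := by
      calc |c * ‖z‖ ^ β + 1| ≤ |c * ‖z‖ ^ β| + |1| := abs_add_le _ _
        _ = |c| * ‖z‖ ^ β + 1 := by rw [abs_mul, abs_of_pos (one_pos.trans_le hone), abs_one]
        _ ≤ (|c| + 1) * ‖z‖ ^ β := by linarith
    have hexp : ‖z‖ ^ (2 * β - 2) = ‖z‖ ^ β * ‖z‖ ^ (β - 2) := by
      rw [← Real.rpow_add hr]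
      ring_nf
    rw [abs_mul, abs_mul, abs_mul, abs_of_nonneg (sq_nonneg β),
      abs_of_pos (Real.rpow_pos_of_pos hr (β - 2)), hexp]
    calc |c| * β ^ 2 * |c * ‖z‖ ^ β + 1| * ‖z‖ ^ (β - 2)
        ≤ |c| * β ^ 2 * ((|c| + 1) * ‖z‖ ^ β) * ‖z‖ ^ (β - 2) := by gcongr
      _ = |c| * β ^ 2 * (|c| + 1) * (‖z‖ ^ β * ‖z‖ ^ (β - 2)) := by ring
end
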